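/- Let 𝒜 be a hyperplane arrangement in ℝⁿ, F a face that is not a chamber, and H, H' two hyperplanes of 𝒜 both containing F. Then the number of chambers C with cl(C) ∩ H = F equals the number of chambers C with cl(C) ∩ H' = F; moreover this number is even. (Hence the multiplicity β_F := #{C : cl(C) ∩ H = F}/2 is well-defined, independent of the choice of H ∈ 𝒜_F.) -/

import Mathlib

attribute [local instance] Classical.propDecidable

noncomputable section

namespace Varchenko

/-- Sign of the point `x` with respect to the hyperplane `⟨a i, x⟩ = b i`. -/
def hsign {n : ℕ} {ι : Type*} (a : ι → Fin n → ℝ) (b : ι → ℝ) (i : ι)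
    (x : Fin n → ℝ) : SignType :=
  SignType.sign (∑ j, a i j * x j - b i)

/-- The set of points realizing the sign vector `σ`. -/
def cell {n : ℕ} {ι : Type*} (a : ι → Fin n → ℝ) (b : ι → ℝ)
    (σ : ι → SignType) : Set (Fin n → ℝ) :=
  {x | ∀ i, hsign a b i x = σ i}

/-- A face is a sign vector with nonempty realization. -/
def IsFace {n : ℕ} {ι : Type*} (a : ι → Fin n → ℝ) (b : ι → ℝ)
    (σ : ι → SignType) : Prop :=
  (cell a b σ).Nonempty

/-- A chamber is a face all of whose signs are nonzero. -/
def IsChamber {n : ℕ} {ι : Type*} (a : ι → Fin n → ℝ) (b : ι → ℝ)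
    (σ : ι → SignType) : Prop :=
  IsFace a b σ ∧ ∀ i, σ i ≠ 0

/-- The Tits product of two sign vectors. -/
def tits {ι : Type*} (σ τ : ι → SignType) : ι → SignType :=
  fun i => if σ i ≠ 0 then σ i else τ i

/-- The face partial order on sign vectors. -/
def faceLE {ι : Type*} (σ τ : ι → SignType) : Prop :=
  ∀ i, σ i ≠ 0 → σ i = τ i

/-- The Aguiar–Mahajan distance function, valued in `ℤ[h_H^± : H ∈ 𝒜]`,
where the variable `h_H^ε` is `X (H, ε)`. -/
def vdist {ι : Type*} [Fintype ι] (C D : ι → SignType) :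
    MvPolynomial (ι × SignType) ℤ :=
  ∏ i ∈ Finset.univ.filter (fun i => C i = -D i), MvPolynomial.X (i, C i)

/-- The set of half-spaces containing `C` but not `D`. -/
def Hset {ι : Type*} [Fintype ι] (C D : ι → SignType) : Finset (ι × SignType) :=
  (Finset.univ.filter (fun i => C i = -D i)).image (fun i => (i, C i))

/-- The weight `b_F = ∏_{H ∈ 𝒜_F} h_H⁺ h_H⁻` of a face. -/
def weight {ι : Type*} [Fintype ι] (σ : ι → SignType) :
    MvPolynomial (ι × SignType) ℤ :=
  ∏ i ∈ Finset.univ.filter (fun i => σ i = 0),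
    (MvPolynomial.X (i, 1) * MvPolynomial.X (i, -1))

/-- The dimension of a face. -/
def fdim {n : ℕ} {ι : Type*} (a : ι → Fin n → ℝ) (b : ι → ℝ)
    (σ : ι → SignType) : ℕ :=
  Module.finrank ℝ (affineSpan ℝ (cell a b σ)).direction

/-- The minimal dimension `c_𝒜` of a face of the arrangement. -/
def minDim {n : ℕ} {ι : Type*} (a : ι → Fin n → ℝ) (b : ι → ℝ) : ℕ :=
  sInf {d : ℕ | ∃ σ, IsFace a b σ ∧ fdim a b σ = d}

/-- The hyperplane with index `i`, as a set. -/
def hplane {n : ℕ} {ι : Type*} (a : ι → Fin n → ℝ) (b : ι → ℝ) (i : ι) :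
    Set (Fin n → ℝ) :=
  {x | hsign a b i x = 0}

/-- The multiplicity `β_F^H` of a face `F`, computed using `H ∈ 𝒜_F`. -/
def betaH {n : ℕ} {ι : Type*} [Fintype ι] (a : ι → Fin n → ℝ) (b : ι → ℝ)
    (i : ι) (σ : ι → SignType) : ℕ :=
  (Finset.univ.filter (fun C : ι → SignType => IsChamber a b C ∧
    closure (cell a b C) ∩ hplane a b i = cell a b σ)).card / 2

end Varchenko

namespace Varchenko

open Finset

/-- The open cone `{x ∈ W | ∀ j ∈ S, 0 < m j x}` is nonempty, and its closure meets the kernel of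
`m i` only in the common kernel of the `m j`, `j ∈ S`. -/
def BoundedCone {V ι : Type*} [AddCommGroup V] [Module ℝ V] (m : ι → V →ₗ[ℝ] ℝ) (S : Finset ι)
    (W : Submodule ℝ V) (i : ι) : Prop :=
  (∃ x ∈ W, ∀ j ∈ S, 0 < m j x) ∧
    ∀ x ∈ W, (∀ j ∈ S, 0 ≤ m j x) → m i x = 0 → ∀ j ∈ S, m j x = 0

section Cone

variable {V ι : Type*} [AddCommGroup V] [Module ℝ V]

lemma exists_pos_forall_add_mul_pos (S : Finset ι) (p q : ι → ℝ) (hp : ∀ j ∈ S, 0 < p j) :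
    ∃ ε : ℝ, 0 < ε ∧ ∀ j ∈ S, 0 < p j + ε * q j := by
  have h : ∀ᶠ ε : ℝ in nhdsWithin 0 (Set.Ioi 0), ∀ j ∈ S, 0 < p j + ε * q j := by
    refine (Filter.eventually_all_finset S).2 fun j hj => ?_
    have hc : Filter.Tendsto (fun ε : ℝ => p j + ε * q j) (nhdsWithin 0 (Set.Ioi 0))
        (nhds (p j + 0 * q j)) := by
      refine Filter.Tendsto.mono_left ?_ nhdsWithin_le_nhds
      exact Continuous.tendsto (by fun_prop) 0
    exact hc.eventually (lt_mem_nhds (by simpa using hp j hj))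
  obtain ⟨ε, h1, h2⟩ := (h.and self_mem_nhdsWithin).exists
  exact ⟨ε, h2, h1⟩

lemma exists_pos_of_exists_zero {m : ι → V →ₗ[ℝ] ℝ} {S : Finset ι} {W : Submodule ℝ V}
    {f : V →ₗ[ℝ] ℝ} (hf : ∃ y ∈ W, f y ≠ 0)
    (h : ∃ x ∈ W, (∀ j ∈ S, 0 < m j x) ∧ f x = 0) :
    ∃ x ∈ W, (∀ j ∈ S, 0 < m j x) ∧ 0 < f x := by
  obtain ⟨y, hy, hfy⟩ := hf
  obtain ⟨x, hx, hS, hfx⟩ := h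
  obtain ⟨ε, hε, h⟩ := exists_pos_forall_add_mul_pos S (fun j => m j x)
    (fun j => f y * m j y) hS
  refine ⟨x + (ε * f y) • y, W.add_mem hx (W.smul_mem _ hy), fun j hj => ?_, ?_⟩
  · simpa [mul_assoc] using h j hj
  · have : 0 < f y * f y := mul_self_pos.2 hfy
    simp only [map_add, map_smul, smul_eq_mul, hfx, zero_add]
    nlinarith [mul_pos hε this]

lemma nonneg_of_forall_nonneg {m : ι → V →ₗ[ℝ] ℝ} {S : Finset ι} {W : Submodule ℝ V}
    {f : V →ₗ[ℝ] ℝ} (hO : ∃ x ∈ W, ∀ j ∈ S, 0 < m j x)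
    (hN : ¬ ∃ x ∈ W, (∀ j ∈ S, 0 < m j x) ∧ f x < 0) {x : V} (hx : x ∈ W)
    (hS : ∀ j ∈ S, 0 ≤ m j x) : 0 ≤ f x := by
  by_contra! hfx
  obtain ⟨p, hp, hpS⟩ := hO
  obtain ⟨ε, hε, h⟩ := exists_pos_forall_add_mul_pos {()} (fun _ => - f x) (fun _ => - f p)
    (by simpa using hfx)
  refine hN ⟨x + ε • p, W.add_mem hx (W.smul_mem _ hp), fun j hj => ?_, ?_⟩
  · have := mul_pos hε (hpS j hj)
    have := hS j hj
    simp only [map_add, map_smul, smul_eq_mul]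
    linarith
  · have := h () (by simp)
    simp only [map_add, map_smul, smul_eq_mul]
    linarith

/-- Deletion–restriction for bounded cones. -/
lemma boundedCone_insert_add {m m' : ι → V →ₗ[ℝ] ℝ} {S : Finset ι} {W : Submodule ℝ V}
    {i k : ι} (hiS : i ∈ S) (hm : ∀ j ∈ S, m' j = m j) (hk : m' k = - m k)
    (hne : ∃ y ∈ W, m k y ≠ 0) (hker : ∀ x ∈ W, (∀ j ∈ S, m j x = 0) → m k x = 0) :
    ((if BoundedCone m (insert k S) W i then 1 else 0) +
      (if BoundedCone m' (insert k S) W i then 1 else 0) : ℕ) =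
    (if BoundedCone m S W i then 1 else 0) +
      (if BoundedCone m S (W ⊓ LinearMap.ker (m k)) i then 1 else 0) := by
  set f := m k with hf
  set P := ∃ x ∈ W, (∀ j ∈ S, 0 < m j x) ∧ 0 < f x with hP
  set N := ∃ x ∈ W, (∀ j ∈ S, 0 < m j x) ∧ f x < 0 with hN
  set Z := ∃ x ∈ W, (∀ j ∈ S, 0 < m j x) ∧ f x = 0 with hZ
  set O := ∃ x ∈ W, ∀ j ∈ S, 0 < m j x with hO
  set bad : V → Prop := fun x => x ∈ W ∧ (∀ j ∈ S, 0 ≤ m j x) ∧ m i x = 0 ∧ ∃ j ∈ S, m j x ≠ 0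
    with hbad
  set Bp := ∀ x, bad x → ¬ 0 ≤ f x with hBp
  set Bn := ∀ x, bad x → ¬ f x ≤ 0 with hBn
  set Bz := ∀ x, bad x → f x ≠ 0 with hBz
  set B := ∀ x, ¬ bad x with hB
  have e1 : BoundedCone m (insert k S) W i ↔ P ∧ Bp := by
    unfold BoundedCone
    refine and_congr ?_ ?_
    · simp only [forall_mem_insert, hP]
      grind
    · simp only [forall_mem_insert, hBp, hbad]
      constructor
      · rintro h x ⟨hx, h1, h2, j, hj, h3⟩ h4
        exact h3 ((h x hx ⟨h4, h1⟩ h2).2 j hj)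
      · intro h x hx h1 h2
        have h3 : ∀ j ∈ S, m j x = 0 := by
          by_contra! h3
          exact h x ⟨hx, h1.2, h2, h3⟩ h1.1
        exact ⟨hker x hx h3, h3⟩
  have e2 : BoundedCone m' (insert k S) W i ↔ N ∧ Bn := by
    unfold BoundedCone
    simp only [forall_mem_insert, hk, hm i hiS, LinearMap.neg_apply, neg_pos, neg_nonneg,
      neg_eq_zero]
    refine and_congr ?_ ?_
    · rw [hN]
      refine exists_congr fun x => and_congr_right fun _ => ?_
      rw [and_comm]
      refine and_congr_left fun _ => forall₂_congr fun j hj => by rw [hm j hj]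
    · simp only [hBn, hbad]
      constructor
      · rintro h x ⟨hx, h1, h2, j, hj, h3⟩ h4
        have := (h x hx ⟨h4, fun j hj => by rw [hm j hj]; exact h1 j hj⟩ h2).2 j hj
        rw [hm j hj] at this
        exact h3 this
      · intro h x hx h1 h2
        have h3 : ∀ j ∈ S, m j x = 0 := by
          by_contra! h3
          exact h x ⟨hx, fun j hj => hm j hj ▸ h1.2 j hj, h2, h3⟩ h1.1
        exact ⟨hker x hx h3, fun j hj => by rw [hm j hj]; exact h3 j hj⟩
  have e3 : BoundedCone m S W i ↔ O ∧ B := by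
    unfold BoundedCone
    refine and_congr Iff.rfl ?_
    simp only [hB, hbad]
    grind
  have e4 : BoundedCone m S (W ⊓ LinearMap.ker f) i ↔ Z ∧ Bz := by
    unfold BoundedCone
    simp only [Submodule.mem_inf, LinearMap.mem_ker]
    refine and_congr ?_ ?_
    · rw [hZ]
      grind
    · simp only [hBz, hbad]
      grind
  have f1 : Z → P := exists_pos_of_exists_zero hne
  have f2 : Z → N := by
    rintro ⟨x, hx, h, h0⟩
    obtain ⟨y, hy, h, h0⟩ := exists_pos_of_exists_zero (f := -f) (by simpa using hne)
      ⟨x, hx, h, by simpa using h0⟩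
    exact ⟨y, hy, h, by simpa using h0⟩
  have f3 : O → P ∨ N := by
    rintro ⟨x, hx, h⟩
    rcases lt_trichotomy (f x) 0 with h0 | h0 | h0
    · exact Or.inr ⟨x, hx, h, h0⟩
    · exact Or.inl (f1 ⟨x, hx, h, h0⟩)
    · exact Or.inl ⟨x, hx, h, h0⟩
  have f4 : P → O := fun ⟨x, hx, h, _⟩ => ⟨x, hx, h⟩
  have f5 : N → O := fun ⟨x, hx, h, _⟩ => ⟨x, hx, h⟩
  have f6 : P → N → Z := by
    rintro ⟨x, hx, h, h0⟩ ⟨y, hy, h', h0'⟩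
    refine ⟨f x • y + (- f y) • x, W.add_mem (W.smul_mem _ hy) (W.smul_mem _ hx),
      fun j hj => ?_, ?_⟩
    · have := mul_pos h0 (h' j hj)
      have := mul_pos (neg_pos.2 h0') (h j hj)
      simp only [map_add, map_smul, smul_eq_mul]
      linarith
    · simp only [map_add, map_smul, smul_eq_mul]
      ring
  have f7 : Bz → Bp ∨ Bn := by
    intro hz
    by_contra! hcon
    obtain ⟨h1, h2⟩ := hcon
    simp only [hBp, hBn, not_forall, not_not] at h1 h2
    obtain ⟨x, hx, h0⟩ := h1
    obtain ⟨y, hy, h0'⟩ := h2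
    have h0 : 0 < f x := lt_of_le_of_ne h0 (hz x hx).symm
    have h0' : f y < 0 := lt_of_le_of_ne h0' (hz y hy)
    obtain ⟨hxW, hx1, hx2, j, hj, hxj⟩ := hx
    obtain ⟨hyW, hy1, hy2, -⟩ := hy
    refine hz (f x • y + (- f y) • x) ⟨W.add_mem (W.smul_mem _ hyW) (W.smul_mem _ hxW),
      fun l hl => ?_, ?_, j, hj, ?_⟩ ?_
    · have := mul_nonneg h0.le (hy1 l hl)
      have := mul_nonneg (neg_pos.2 h0').le (hx1 l hl)
      simp only [map_add, map_smul, smul_eq_mul]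
      linarith
    · simp [hx2, hy2]
    · have := mul_nonneg h0.le (hy1 j hj)
      have := mul_pos (neg_pos.2 h0') (lt_of_le_of_ne (hx1 j hj) hxj.symm)
      simp only [map_add, map_smul, smul_eq_mul]
      linarith
    · simp only [map_add, map_smul, smul_eq_mul]
      ring
  have f8 : B ↔ Bp ∧ Bn := by
    simp only [hB, hBp, hBn]
    constructor
    · intro h
      exact ⟨fun x hx => (h x hx).elim, fun x hx => (h x hx).elim⟩
    · rintro ⟨h, h'⟩ x hx
      rcases le_total 0 (f x) with h0 | h0
      exacts [h x hx h0, h' x hx h0]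
  have f9 : Bp → Bz := fun h x hx h0 => h x hx h0.ge
  have f10 : Bn → Bz := fun h x hx h0 => h x hx h0.le
  have f11 : O → ¬ N → Bp → Bn := by
    intro ho hn hp x hx _
    exact hp x hx (nonneg_of_forall_nonneg ho hn hx.1 hx.2.1)
  have f12 : O → ¬ P → Bn → Bp := by
    intro ho hp hn x hx _
    refine hn x hx ?_
    have := nonneg_of_forall_nonneg (f := -f) ho
      (by simpa only [LinearMap.neg_apply, neg_lt_zero] using hp) hx.1 hx.2.1
    simpa using this
  simp only [e1, e2, e3, e4]
  clear_value P N Z O Bp Bn Bz B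
  clear * - f1 f2 f3 f4 f5 f6 f7 f8 f9 f10 f11 f12
  have hO' : O ↔ P ∨ N := ⟨f3, fun h => h.elim f4 f5⟩
  have hZ' : Z ↔ P ∧ N := ⟨fun h => ⟨f1 h, f2 h⟩, fun h => f6 h.1 h.2⟩
  have hBz' : Bz ↔ Bp ∨ Bn := ⟨f7, fun h => h.elim f9 f10⟩
  rw [hO'] at f11 f12
  simp only [hO', hZ', hBz', f8]
  clear * - f11 f12
  by_cases hP' : P <;> by_cases hN' : N <;> by_cases hBp' : Bp <;> by_cases hBn' : Bn <;>
    simp_all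

lemma not_boundedCone_of_exists {m : ι → V →ₗ[ℝ] ℝ} {S : Finset ι} {W : Submodule ℝ V}
    {i k : ι} (hi : i ∈ S) (h : ∃ x ∈ W, (∀ j ∈ S, m j x = 0) ∧ m k x ≠ 0) :
    ¬ BoundedCone m (insert k S) W i := by
  rintro ⟨-, hb⟩
  obtain ⟨x, hx, h0, hk⟩ := h
  rcases le_total 0 (m k x) with h1 | h1
  · exact hk (hb x hx (by
      simp only [forall_mem_insert]
      exact ⟨h1, fun j hj => (h0 j hj).ge⟩) (h0 i hi) k (mem_insert_self _ _))
  · have := hb (-x) (W.neg_mem hx) (by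
      simp only [forall_mem_insert, map_neg, neg_nonneg]
      exact ⟨h1, fun j hj => (h0 j hj).le⟩) (by simp [h0 i hi]) k (mem_insert_self _ _)
    exact hk (by simpa using this)

lemma boundedCone_pair_comm {m : ι → V →ₗ[ℝ] ℝ} {W : Submodule ℝ V} {i j : ι}
    (h : BoundedCone m {i, j} W i) : BoundedCone m {i, j} W j := by
  have hij : ∀ x ∈ W, m i x = 0 → m j x = 0 := by
    intro x hx h0
    by_contra hne
    refine not_boundedCone_of_exists (S := {i}) (k := j) (mem_singleton_self i) ⟨x, hx, by simpa using h0, hne⟩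
      ?_
    rwa [Finset.pair_comm] at h
  obtain ⟨p, hp, hpS⟩ := h.1
  have hpi : 0 < m i p := hpS i (by simp)
  have hpj : 0 < m j p := hpS j (by simp)
  refine ⟨h.1, fun x hx hS h0 => ?_⟩
  have key := hij (m i p • x - m i x • p) (W.sub_mem (W.smul_mem _ hx) (W.smul_mem _ hp))
    (by simp only [map_sub, map_smul, smul_eq_mul]; ring)
  simp only [map_sub, map_smul, smul_eq_mul, h0, mul_zero, zero_sub, neg_eq_zero] at key
  have : m i x = 0 := (mul_eq_zero.1 key).resolve_right hpj.ne'
  simp [this, h0]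

end Cone

/-- The functionals `ℓ j` with the signs `σ j`. -/
def signed {V ι : Type*} [AddCommGroup V] [Module ℝ V] (ℓ : ι → V →ₗ[ℝ] ℝ) (σ : ι → SignType)
    (j : ι) : V →ₗ[ℝ] ℝ :=
  ((σ j : SignType) : ℝ) • ℓ j

lemma sum_boundedCone_eq {V ι : Type*} [AddCommGroup V] [Module ℝ V] (ℓ : ι → V →ₗ[ℝ] ℝ)
    (X : Finset (ι → SignType)) (i i' : ι) (S : Finset ι)
    (h0 : ∀ σ ∈ X, ∀ j, σ j ≠ 0)
    (hX : ∀ σ ∈ X, ∀ k ∈ S, Function.update σ k (- σ k) ∈ X) (W : Submodule ℝ V) :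
    ∑ σ ∈ X, (if BoundedCone (signed ℓ σ) (S ∪ {i, i'}) W i then 1 else 0 : ℕ) =
      ∑ σ ∈ X, if BoundedCone (signed ℓ σ) (S ∪ {i, i'}) W i' then 1 else 0 := by
  have hs : ∀ σ ∈ X, ∀ j, ((σ j : SignType) : ℝ) ≠ 0 := by
    intro σ hσ j
    have := h0 σ hσ j
    generalize σ j = s at this
    cases s <;> simp_all
  induction S using Finset.induction_on generalizing W with
  | empty =>
    refine sum_congr rfl fun σ _ => ?_
    simp only [empty_union]
    refine if_congr ⟨boundedCone_pair_comm, fun h => ?_⟩ rfl rfl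
    rw [Finset.pair_comm] at h ⊢
    exact boundedCone_pair_comm h
  | insert k S hk ih =>
    replace ih := ih fun σ hσ l hl => hX σ hσ l (mem_insert_of_mem hl)
    rw [insert_union]
    have hiT : i ∈ S ∪ {i, i'} := by simp
    have hiT' : i' ∈ S ∪ {i, i'} := by simp
    generalize S ∪ {i, i'} = T at *
    by_cases hkT : k ∈ T
    · rw [insert_eq_of_mem hkT]
      exact ih W
    by_cases hne : ∃ y ∈ W, ℓ k y ≠ 0
    swap
    · have hn : ∀ σ l, ¬ BoundedCone (signed ℓ σ) (insert k T) W l := by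
        rintro σ l ⟨⟨x, hx, h⟩, -⟩
        have := h k (mem_insert_self _ _)
        push Not at hne
        simp [signed, hne x hx] at this
      simp [hn]
    by_cases hker : ∀ x ∈ W, (∀ j ∈ T, ℓ j x = 0) → ℓ k x = 0
    swap
    · push Not at hker
      obtain ⟨x, hx, h1, h2⟩ := hker
      have hn : ∀ σ ∈ X, ∀ l ∈ T, ¬ BoundedCone (signed ℓ σ) (insert k T) W l := by
        intro σ hσ l hl
        refine not_boundedCone_of_exists hl ⟨x, hx, fun j hj => by simp [signed, h1 j hj], ?_⟩
        simpa [signed, h2] using hs σ hσ k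
      rw [sum_congr rfl fun σ hσ => if_neg (hn σ hσ i hiT),
        sum_congr rfl fun σ hσ => if_neg (hn σ hσ i' hiT')]
    have key : ∀ l ∈ T, 2 * ∑ σ ∈ X,
        (if BoundedCone (signed ℓ σ) (insert k T) W l then 1 else 0 : ℕ) =
        (∑ σ ∈ X, if BoundedCone (signed ℓ σ) T W l then 1 else 0) +
        ∑ σ ∈ X, if BoundedCone (signed ℓ σ) T (W ⊓ LinearMap.ker (ℓ k)) l then 1 else 0 := by
      intro l hl
      have hflip : ∑ σ ∈ X,
          (if BoundedCone (signed ℓ σ) (insert k T) W l then 1 else 0 : ℕ) =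
          ∑ σ ∈ X, if BoundedCone (signed ℓ (Function.update σ k (- σ k))) (insert k T) W l
            then 1 else 0 := by
        refine sum_nbij' (fun σ => Function.update σ k (- σ k))
          (fun σ => Function.update σ k (- σ k)) ?_ ?_ ?_ ?_ ?_
        · exact fun σ hσ => hX σ hσ k (mem_insert_self _ _)
        · exact fun σ hσ => hX σ hσ k (mem_insert_self _ _)
        · intro σ _
          simp
        · intro σ _
          simp
        · intro σ _
          simp
      rw [two_mul]
      nth_rewrite 2 [hflip]
      rw [← sum_add_distrib, ← sum_add_distrib]
      refine sum_congr rfl fun σ hσ => ?_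
      have hkk : LinearMap.ker (ℓ k) = LinearMap.ker (signed ℓ σ k) :=
        (LinearMap.ker_smul _ _ (hs σ hσ k)).symm
      rw [hkk]
      refine boundedCone_insert_add hl ?_ ?_ ?_ ?_
      · intro j hj
        have : j ≠ k := fun h => hkT (h ▸ hj)
        simp [signed, this]
      · simp only [signed, Function.update_self, SignType.coe_neg]
        ext x
        simp
      · obtain ⟨y, hy, h⟩ := hne
        exact ⟨y, hy, by simpa [signed, h] using hs σ hσ k⟩
      · intro x hx h
        have := hker x hx fun j hj => by simpa [signed, hs σ hσ j] using h j hj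
        simp [signed, this]
    have := key i hiT
    have := key i' hiT'
    have := ih W
    have := ih (W ⊓ LinearMap.ker (ℓ k))
    lia

/-- The linear part of the equation of the `j`-th hyperplane. -/
def normal {n : ℕ} {ι : Type*} (a : ι → Fin n → ℝ) (j : ι) : (Fin n → ℝ) →ₗ[ℝ] ℝ :=
  ∑ l, a j l • LinearMap.proj l

section Geometry

variable {n : ℕ} {ι : Type*} {a : ι → Fin n → ℝ} {b : ι → ℝ}

lemma hsign_eq (j : ι) (x : Fin n → ℝ) : hsign a b j x = SignType.sign (normal a j x - b j) := by
  simp [hsign, normal, LinearMap.sum_apply]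

lemma sign_eq_iff_mul_pos {s : SignType} (hs : s ≠ 0) (t : ℝ) :
    SignType.sign t = s ↔ 0 < (s : ℝ) * t := by
  cases s <;> simp_all [sign_eq_neg_one_iff, sign_eq_one_iff]

lemma continuous_normal (j : ι) : Continuous (normal a j) :=
  LinearMap.continuous_of_finiteDimensional _

lemma mem_cell_iff {C : ι → SignType} (hC : ∀ j, C j ≠ 0) (x : Fin n → ℝ) :
    x ∈ cell a b C ↔ ∀ j, 0 < (C j : ℝ) * (normal a j x - b j) := by
  simp only [cell, Set.mem_ofPred_eq, hsign_eq]
  exact forall_congr' fun j => sign_eq_iff_mul_pos (hC j) _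

lemma mem_hplane_iff (j : ι) (x : Fin n → ℝ) : x ∈ hplane a b j ↔ normal a j x - b j = 0 := by
  simp [hplane, hsign_eq, sign_eq_zero_iff]

lemma isClosed_hplane (j : ι) : IsClosed (hplane a b j) := by
  have : hplane a b j = {x | normal a j x - b j = 0} := Set.ext (mem_hplane_iff j)
  rw [this]
  exact isClosed_eq ((continuous_normal j).sub continuous_const) continuous_const

lemma mem_closure_of_forall_smul_add {s : Set (Fin n → ℝ)} {x y : Fin n → ℝ}
    (h : ∀ t : ℝ, 0 < t → t < 1 → y + t • (x - y) ∈ s) : y ∈ closure s := by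
  have hc : Filter.Tendsto (fun t : ℝ => y + t • (x - y)) (nhdsWithin 0 (Set.Ioi 0)) (nhds y) := by
    refine Filter.Tendsto.mono_left ?_ nhdsWithin_le_nhds
    exact Continuous.tendsto' (by fun_prop) _ _ (by simp)
  refine mem_closure_of_tendsto hc ?_
  filter_upwards [Ioo_mem_nhdsGT (zero_lt_one (α := ℝ))] with t ht using h t ht.1 ht.2

lemma normal_segment (j : ι) (x y : Fin n → ℝ) (t : ℝ) :
    normal a j (y + t • (x - y)) - b j =
      (1 - t) * (normal a j y - b j) + t * (normal a j x - b j) := by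
  simp only [map_add, map_smul, map_sub, smul_eq_mul]
  ring

lemma mem_closure_cell_iff {C : ι → SignType} (hC : IsChamber a b C) (y : Fin n → ℝ) :
    y ∈ closure (cell a b C) ↔ ∀ j, 0 ≤ (C j : ℝ) * (normal a j y - b j) := by
  obtain ⟨⟨x, hx⟩, hC⟩ := hC
  constructor
  · intro hy j
    have hcl : IsClosed {y | 0 ≤ (C j : ℝ) * (normal a j y - b j)} :=
      isClosed_le continuous_const
        (continuous_const.mul ((continuous_normal j).sub continuous_const))
    exact closure_minimal (fun z hz => ((mem_cell_iff hC z).1 hz j).le) hcl hy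
  · intro hy
    refine mem_closure_of_forall_smul_add (x := x) fun t ht ht1 => (mem_cell_iff hC _).2 fun j => ?_
    rw [normal_segment]
    have := mul_pos ht ((mem_cell_iff hC x).1 hx j)
    have := mul_nonneg (sub_nonneg.2 ht1.le) (hy j)
    linarith

variable [Fintype ι]

/-- If `p` lies in the face `F`, then moving slightly from `p` does not change the signs of the
hyperplanes not containing `F`. -/
lemma exists_pos_perturb {F : ι → SignType} {p : Fin n → ℝ} (hp : p ∈ cell a b F)
    (v : Fin n → ℝ) : ∃ ε : ℝ, 0 < ε ∧ ∀ j,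
      (F j ≠ 0 → 0 < (F j : ℝ) * (normal a j (p + ε • v) - b j)) ∧
      (F j = 0 → normal a j (p + ε • v) - b j = ε * normal a j v) := by
  obtain ⟨ε, hε, h⟩ := exists_pos_forall_add_mul_pos (univ.filter fun j => F j ≠ 0)
    (fun j => (F j : ℝ) * (normal a j p - b j)) (fun j => (F j : ℝ) * normal a j v) (by
      intro j hj
      have hj : F j ≠ 0 := by simpa using hj
      have := hp j
      rw [hsign_eq] at this
      exact (sign_eq_iff_mul_pos hj _).1 this)
  refine ⟨ε, hε, fun j => ⟨fun hj => ?_, fun hj => ?_⟩⟩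
  · have := h j (by simpa using hj)
    simp only [map_add, map_smul, smul_eq_mul]
    linarith
  · have := hp j
    rw [hsign_eq, hj, sign_eq_zero_iff] at this
    simp only [map_add, map_smul, smul_eq_mul]
    linarith

lemma closure_cell_inter_hplane_iff {F : ι → SignType} (hF : IsFace a b F)
    (hcl : IsClosed (cell a b F)) {i : ι} (hi : F i = 0) (C : ι → SignType) :
    (IsChamber a b C ∧ closure (cell a b C) ∩ hplane a b i = cell a b F) ↔
      (∀ j, C j ≠ 0 ∧ (F j ≠ 0 → C j = F j)) ∧
        BoundedCone (signed (normal a) C) (univ.filter fun j => F j = 0) ⊤ i := by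
  obtain ⟨p, hp⟩ := hF
  have hpF : ∀ j, F j = 0 → normal a j p - b j = 0 := by
    intro j hj
    have := hp j
    rwa [hsign_eq, hj, sign_eq_zero_iff] at this
  have hpF' : ∀ j, F j ≠ 0 → 0 < (F j : ℝ) * (normal a j p - b j) := by
    intro j hj
    have := hp j
    rw [hsign_eq] at this
    exact (sign_eq_iff_mul_pos hj _).1 this
  simp only [BoundedCone, signed, mem_filter, mem_univ, true_and, Submodule.mem_top,
    LinearMap.smul_apply, smul_eq_mul, forall_true_left, mul_eq_zero]
  constructor
  · rintro ⟨hC, h⟩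
    have hpC : p ∈ closure (cell a b C) := (h.ge hp).1
    have hCF : ∀ j, F j ≠ 0 → C j = F j := by
      intro j hj
      have h1 := (mem_closure_cell_iff hC p).1 hpC j
      have h2 := hpF' j hj
      have h3 := hC.2 j
      generalize C j = s at *
      generalize F j = s' at *
      cases s <;> cases s' <;> simp_all <;> linarith
    refine ⟨fun j => ⟨hC.2 j, hCF j⟩, ?_, ?_⟩
    · obtain ⟨x, hx⟩ := hC.1
      refine ⟨x - p, fun j hj => ?_⟩
      have h1 := (mem_cell_iff hC.2 x).1 hx j
      have h2 := hpF j hj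
      rw [map_sub]
      have : normal a j x - normal a j p = normal a j x - b j := by linarith
      rwa [this]
    · intro v hv hiv j hj
      right
      have hiv : normal a i v = 0 := hiv.resolve_left (by
        have := hC.2 i
        generalize C i = s at *
        cases s <;> simp_all)
      obtain ⟨ε, hε, hεv⟩ := exists_pos_perturb hp v
      have hmem : p + ε • v ∈ closure (cell a b C) ∩ hplane a b i := by
        refine ⟨(mem_closure_cell_iff hC _).2 fun l => ?_, (mem_hplane_iff i _).2 ?_⟩
        · by_cases hl : F l = 0
          · rw [(hεv l).2 hl]
            have := mul_nonneg hε.le (hv l hl)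
            linarith
          · rw [hCF l hl]
            exact ((hεv l).1 hl).le
        · rw [(hεv i).2 hi, hiv, mul_zero]
      rw [h] at hmem
      have := hmem j
      rw [hsign_eq, hj, sign_eq_zero_iff, (hεv j).2 hj] at this
      exact (mul_eq_zero.1 this).resolve_left hε.ne'
  · rintro ⟨hCF, ⟨v, hv⟩, hb⟩
    have hC0 : ∀ j, (C j : ℝ) ≠ 0 := by
      intro j
      have := (hCF j).1
      generalize C j = s at *
      cases s <;> simp_all
    have hC : IsChamber a b C := by
      refine ⟨?_, fun j => (hCF j).1⟩
      obtain ⟨ε, hε, hεv⟩ := exists_pos_perturb hp v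
      refine ⟨p + ε • v, (mem_cell_iff (fun j => (hCF j).1) _).2 fun j => ?_⟩
      by_cases hj : F j = 0
      · rw [(hεv j).2 hj]
        have := mul_pos hε (hv j hj)
        linarith
      · rw [(hCF j).2 hj]
        exact (hεv j).1 hj
    refine ⟨hC, Set.Subset.antisymm ?_ ?_⟩
    · rintro y ⟨hy, hyi⟩
      rw [mem_closure_cell_iff hC] at hy
      rw [mem_hplane_iff] at hyi
      have hsub : ∀ j, F j = 0 → normal a j (y - p) = normal a j y - b j := by
        intro j hj
        have := hpF j hj
        rw [map_sub]
        linarith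
      have hy0 : ∀ j, F j = 0 → normal a j y - b j = 0 := by
        intro j hj
        have := hb (y - p) (fun l hl => by rw [hsub l hl]; exact hy l)
          (Or.inr (by rw [hsub i hi, hyi])) j hj
        rw [hsub j hj] at this
        exact this.resolve_left (hC0 j)
      rw [← hcl.closure_eq]
      refine mem_closure_of_forall_smul_add (x := p) fun t ht ht1 j => ?_
      rw [hsign_eq, normal_segment]
      by_cases hj : F j = 0
      · rw [hj, hy0 j hj, hpF j hj]
        simp
      · rw [sign_eq_iff_mul_pos hj]
        have h1 := mul_pos ht (hpF' j hj)
        have h2 := mul_nonneg (sub_nonneg.2 ht1.le) (hy j)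
        rw [(hCF j).2 hj] at h2
        linarith
    · intro y hy
      refine ⟨(mem_closure_cell_iff hC y).2 fun j => ?_, ?_⟩
      · have := hy j
        rw [hsign_eq] at this
        by_cases hj : F j = 0
        · rw [hj, sign_eq_zero_iff] at this
          simp [this]
        · rw [(hCF j).2 hj]
          exact ((sign_eq_iff_mul_pos hj _).1 this).le
      · have := hy i
        rwa [hi] at this

end Geometry

lemma BoundedCone.of_neg {V ι : Type*} [AddCommGroup V] [Module ℝ V] {m m' : ι → V →ₗ[ℝ] ℝ}
    {S : Finset ι} {W : Submodule ℝ V} {i : ι} (hi : i ∈ S) (h : BoundedCone m S W i)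
    (hm : ∀ j ∈ S, m' j = - m j) : BoundedCone m' S W i := by
  obtain ⟨⟨x, hx, hS⟩, hb⟩ := h
  refine ⟨⟨-x, W.neg_mem hx, fun j hj => by simpa [hm j hj] using hS j hj⟩, ?_⟩
  intro y hy h1 h2 j hj
  have := hb (-y) (W.neg_mem hy) (fun l hl => by simpa [hm l hl] using h1 l hl)
    (by simpa [hm i hi] using h2) j hj
  simpa [hm j hj] using this

lemma two_dvd_card_of_involution {α : Type*} (s : Finset α) (g : α → α)
    (hs : ∀ x ∈ s, g x ∈ s) (hg : ∀ x ∈ s, g (g x) = x) (hne : ∀ x ∈ s, g x ≠ x) :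
    2 ∣ s.card := by
  have h : ∑ x ∈ s, (1 : ZMod 2) = 0 :=
    sum_involution (fun x _ => g x) (fun _ _ => by decide) (fun x hx _ => hne x hx) hs hg
  rw [sum_const, nsmul_eq_mul, mul_one] at h
  exact (ZMod.natCast_eq_zero_iff _ _).1 h

end Varchenko

namespace Varchenko

theorem multiplicity_well_defined {n : ℕ} {ι : Type*} [Fintype ι]
    (a : ι → Fin n → ℝ) (b : ι → ℝ) (ha : ∀ i, a i ≠ 0)
    (F : ι → SignType) (hF : IsFace a b F) (hnc : ¬ IsChamber a b F)
    (i i' : ι) (hi : F i = 0) (hi' : F i' = 0) :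
    (Finset.univ.filter (fun C : ι → SignType => IsChamber a b C ∧
        closure (cell a b C) ∩ hplane a b i = cell a b F)).card =
      (Finset.univ.filter (fun C : ι → SignType => IsChamber a b C ∧
        closure (cell a b C) ∩ hplane a b i' = cell a b F)).card ∧
    2 ∣ (Finset.univ.filter (fun C : ι → SignType => IsChamber a b C ∧
        closure (cell a b C) ∩ hplane a b i = cell a b F)).card := by
  by_cases hcl : IsClosed (cell a b F)
  swap
  · have hn : ∀ l (C : ι → SignType),
        ¬ (IsChamber a b C ∧ closure (cell a b C) ∩ hplane a b l = cell a b F) :=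
      fun l C h => hcl (h.2 ▸ isClosed_closure.inter (isClosed_hplane l))
    simp [hn]
  set X : Finset (ι → SignType) :=
    Finset.univ.filter fun C => ∀ j, C j ≠ 0 ∧ (F j ≠ 0 → C j = F j) with hX
  set S : Finset ι := Finset.univ.filter fun j => F j = 0 with hS
  have hfilter : ∀ l, F l = 0 → (Finset.univ.filter fun C : ι → SignType => IsChamber a b C ∧
      closure (cell a b C) ∩ hplane a b l = cell a b F) =
      X.filter fun C => BoundedCone (signed (normal a) C) S ⊤ l := by
    intro l hl
    ext C
    simp only [hX, hS, Finset.mem_filter, Finset.mem_univ, true_and,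
      closure_cell_inter_hplane_iff hF hcl hl]
  rw [hfilter i hi, hfilter i' hi']
  have hiS : i ∈ S := by simp [hS, hi]
  have hiS' : i' ∈ S := by simp [hS, hi']
  constructor
  · have hSS : S ∪ {i, i'} = S :=
      Finset.union_eq_left.2 (by simp [Finset.insert_subset_iff, hiS, hiS'])
    have := sum_boundedCone_eq (normal a) X i i' S
      (fun σ hσ j => ((Finset.mem_filter.1 hσ).2 j).1) (by
        intro σ hσ k hk
        have hσ := (Finset.mem_filter.1 hσ).2
        have hk : F k = 0 := (Finset.mem_filter.1 hk).2
        refine Finset.mem_filter.2 ⟨Finset.mem_univ _, fun j => ?_⟩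
        by_cases hj : j = k
        · subst hj
          simpa [hk] using (hσ j).1
        · simpa [hj] using hσ j) ⊤
    rw [hSS] at this
    rwa [Finset.card_filter, Finset.card_filter]
  · refine two_dvd_card_of_involution _ (fun C j => if F j = 0 then - C j else C j) ?_ ?_ ?_
    · intro C hC
      obtain ⟨hCX, hC⟩ := Finset.mem_filter.1 hC
      refine Finset.mem_filter.2 ⟨Finset.mem_filter.2 ⟨Finset.mem_univ _, fun j => ?_⟩,
        hC.of_neg hiS fun j hj => ?_⟩
      · have := (Finset.mem_filter.1 hCX).2 j
        by_cases hj : F j = 0 <;> simpa [hj] using this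
      · have hj : F j = 0 := (Finset.mem_filter.1 hj).2
        simp only [signed, hj, if_true, SignType.coe_neg]
        ext x
        simp
    · intro C _
      funext j
      by_cases hj : F j = 0 <;> simp [hj]
    · intro C hC h
      have h1 := ((Finset.mem_filter.1 (Finset.mem_filter.1 hC).1).2 i).1
      have h2 := congrFun h i
      simp only [hi, if_true] at h2
      generalize C i = s at *
      revert h1 h2
      cases s <;> decide

end Varchenko
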